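/- Let p(u, x, y) = μ(u) f(x | u) g(y | u, x) and p*(u, x, y) = μ(u) f*(x | u) g(y | u, x) be two regime-factorized joint distributions over the same finite nonempty types U, X, Y, sharing the same μ and g but with possibly different kernels f and f*. Fix x ∈ X such that both p and p* assign positive probability to (U = u, X = x) for every u in the support of μ. Then the backdoor-adjusted quantity computed from p equals the one computed from p*: Σ_u p(y | x, u) μ(u) = Σ_u p*(y | x, u) μ(u) for every y, and both equal Σ_u g(y | u, x) μ(u). Hence the adjusted (interventional) conditional distribution of Y given X = x is transportable across regimes that affect only the mechanism generating X from U. -/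

import Mathlib

open Finset

/-- `p` is a probability mass function on a finite type. -/
def IsPMF {α : Type*} [Fintype α] (p : α → ℝ) : Prop :=
  (∀ a, 0 ≤ p a) ∧ ∑ a, p a = 1

/-- The regime-factorized joint distribution `p(u, x, y) = μ(u) · f(x | u) · g(y | u, x)`. -/
def joint {U X Y : Type*} (μ : U → ℝ) (f : U → X → ℝ) (g : U → X → Y → ℝ)
    (u : U) (x : X) (y : Y) : ℝ :=
  μ u * f u x * g u x y

/-- The `(U, X)`-marginal `p(u, x)` of the regime-factorized joint distribution. -/
def margUX {U X Y : Type*} [Fintype Y] (μ : U → ℝ) (f : U → X → ℝ)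
    (g : U → X → Y → ℝ) (u : U) (x : X) : ℝ :=
  ∑ y, joint μ f g u x y

/-- The conditional probability `p(y | x, u)`, a ratio of marginals. -/
noncomputable def condYXU {U X Y : Type*} [Fintype Y] (μ : U → ℝ) (f : U → X → ℝ)
    (g : U → X → Y → ℝ) (y : Y) (x : X) (u : U) : ℝ :=
  joint μ f g u x y / margUX μ f g u x

/-- Summing out `Y` leaves `p(u, x) = μ(u) · f(x | u)`. -/
theorem margUX_eq {U X Y : Type*} [Fintype Y] (μ : U → ℝ) (f : U → X → ℝ)
    (g : U → X → Y → ℝ) {u : U} {x : X} (hg : IsPMF (g u x)) :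
    margUX μ f g u x = μ u * f u x := by
  simp only [margUX, joint, ← Finset.mul_sum, hg.2, mul_one]

/-- The conditional `p(y | x, u)` is the kernel `g(y | u, x)` wherever `p(u, x) > 0`. -/
theorem condYXU_eq {U X Y : Type*} [Fintype Y] (μ : U → ℝ) (f : U → X → ℝ)
    (g : U → X → Y → ℝ) {u : U} {x : X} (hg : IsPMF (g u x))
    (h : 0 < margUX μ f g u x) (y : Y) : condYXU μ f g y x u = g u x y := by
  rw [margUX_eq μ f g hg] at h
  rw [condYXU, margUX_eq μ f g hg, joint, mul_div_cancel_left₀ _ h.ne']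

/-- The backdoor adjustment formula: the adjusted quantity depends only on `μ` and `g`. -/
theorem sum_condYXU_mul_eq {U X Y : Type*} [Fintype U] [Fintype Y] (μ : U → ℝ)
    (f : U → X → ℝ) (g : U → X → Y → ℝ) (hμ : ∀ u, 0 ≤ μ u) {x : X}
    (hg : ∀ u, IsPMF (g u x)) (hx : ∀ u, 0 < μ u → 0 < margUX μ f g u x) (y : Y) :
    ∑ u, condYXU μ f g y x u * μ u = ∑ u, g u x y * μ u := by
  refine Finset.sum_congr rfl fun u _ => ?_
  rcases (hμ u).eq_or_lt with h | h
  · simp [← h]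
  · rw [condYXU_eq μ f g (hg u) (hx u h)]

/-- Let `p` and `p*` be regime-factorized joints sharing `μ` and `g` but with kernels
`f` and `f*`.  If `x` is such that both `p` and `p*` assign positive probability to
`(U = u, X = x)` for every `u` in the support of `μ`, then the backdoor-adjusted quantities
agree, `Σ_u p(y | x, u) μ(u) = Σ_u p*(y | x, u) μ(u)`, and both equal
`Σ_u g(y | u, x) μ(u)`: the adjusted conditional of `Y` given `X = x` is transportable
across regimes that affect only the mechanism generating `X` from `U`. -/
theorem statement3 {U X Y : Type*} [Fintype U] [Fintype X] [Fintype Y]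
    (μ : U → ℝ) (f fstar : U → X → ℝ) (g : U → X → Y → ℝ)
    (hμ : IsPMF μ) (hf : ∀ u, IsPMF (f u)) (hfstar : ∀ u, IsPMF (fstar u))
    (hg : ∀ u x, IsPMF (g u x))
    (x : X)
    (hx : ∀ u, 0 < μ u → 0 < margUX μ f g u x ∧ 0 < margUX μ fstar g u x) :
    ∀ y, (∑ u, condYXU μ f g y x u * μ u) = (∑ u, condYXU μ fstar g y x u * μ u) ∧
      (∑ u, condYXU μ f g y x u * μ u) = ∑ u, g u x y * μ u := by
  intro y
  have h := sum_condYXU_mul_eq μ f g hμ.1 (fun u => hg u x) (fun u hu => (hx u hu).1) y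
  have hstar :=
    sum_condYXU_mul_eq μ fstar g hμ.1 (fun u => hg u x) (fun u hu => (hx u hu).2) y
  exact ⟨h.trans hstar.symm, h⟩
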